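/- Let ρ, μ ∈ ℝ and σ > 0, and let Y be distributed according to the Gaussian measure on ℝ with mean μ and variance σ². Then the expected improvement E[max(0, ρ − Y)] = ∫ max(0, ρ − y) dN(μ,σ²)(y) equals (ρ − μ)·Φ(z) + σ·φ(z), where z = (ρ − μ)/σ. -/

import Mathlib

open MeasureTheory ProbabilityTheory

/-- The standard normal probability density function. -/
noncomputable def stdNormalPDF (z : ℝ) : ℝ := Real.exp (-z ^ 2 / 2) / Real.sqrt (2 * Real.pi)

/-- The standard normal cumulative distribution function. -/
noncomputable def stdNormalCDF (z : ℝ) : ℝ := ∫ t in Set.Iic z, stdNormalPDF t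

lemma stdNormalPDF_eq_gaussianPDFReal : stdNormalPDF = gaussianPDFReal 0 1 := by
  ext x
  simp [stdNormalPDF, gaussianPDFReal]
  ring

lemma integrable_stdNormalPDF : Integrable stdNormalPDF := by
  rw [stdNormalPDF_eq_gaussianPDFReal]
  exact integrable_gaussianPDFReal 0 1

lemma integrable_mul_stdNormalPDF : Integrable fun x ↦ x * stdNormalPDF x := by
  refine ((integrable_mul_exp_neg_mul_sq (b := 1 / 2) (by norm_num)).div_const
    (Real.sqrt (2 * Real.pi))).congr (.of_forall fun x ↦ ?_)
  simp only [stdNormalPDF]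
  rw [mul_div_assoc]
  congr 3
  ring

lemma integrable_neg_mul_stdNormalPDF : Integrable fun x ↦ -x * stdNormalPDF x := by
  simpa only [neg_mul] using integrable_mul_stdNormalPDF.fun_neg

lemma hasDerivAt_stdNormalPDF (x : ℝ) : HasDerivAt stdNormalPDF (-x * stdNormalPDF x) x := by
  have h : HasDerivAt (fun y : ℝ ↦ -y ^ 2 / 2) (-x) x :=
    ((hasDerivAt_pow 2 x).neg.div_const 2).congr_deriv (by simp; ring)
  exact (h.exp.div_const _).congr_deriv (by simp only [stdNormalPDF]; ring)

lemma tendsto_stdNormalPDF_atBot : Filter.Tendsto stdNormalPDF Filter.atBot (nhds 0) := by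
  have h : Filter.Tendsto (fun y : ℝ ↦ -y ^ 2 / 2) Filter.atBot Filter.atBot := by
    have h' : Filter.Tendsto (fun y : ℝ ↦ y ^ 2) Filter.atBot Filter.atTop := by
      simpa [Function.comp_def] using
        (Filter.tendsto_pow_atTop two_ne_zero).comp (Filter.tendsto_abs_atBot_atTop (G := ℝ))
    exact (Filter.tendsto_neg_atTop_atBot.comp h').atBot_div_const two_pos
  rw [← zero_div (Real.sqrt (2 * Real.pi))]
  exact (Real.tendsto_exp_atBot.comp h).div_const _

lemma integral_Iic_neg_mul_stdNormalPDF (z : ℝ) :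
    ∫ x in Set.Iic z, -x * stdNormalPDF x = stdNormalPDF z := by
  rw [integral_Iic_of_hasDerivAt_of_tendsto' (fun x _ ↦ hasDerivAt_stdNormalPDF x)
    integrable_neg_mul_stdNormalPDF.integrableOn tendsto_stdNormalPDF_atBot, sub_zero]

lemma integral_max_sub_gaussianReal_zero_one (z : ℝ) :
    ∫ x, max 0 (z - x) ∂(gaussianReal 0 1) = z * stdNormalCDF z + stdNormalPDF z := by
  have hind (x : ℝ) : stdNormalPDF x • max 0 (z - x) =
      (Set.Iic z).indicator (fun x ↦ z * stdNormalPDF x + -x * stdNormalPDF x) x := by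
    by_cases hx : x ≤ z
    · rw [Set.indicator_of_mem (Set.mem_Iic.2 hx), max_eq_right (sub_nonneg.2 hx), smul_eq_mul]
      ring
    · rw [Set.indicator_of_notMem (by simpa using hx), max_eq_left (by linarith), smul_zero]
  rw [integral_gaussianReal_eq_integral_smul one_ne_zero, ← stdNormalPDF_eq_gaussianPDFReal]
  simp_rw [hind]
  rw [integral_indicator measurableSet_Iic,
    integral_add (integrable_stdNormalPDF.const_mul z).integrableOn
      integrable_neg_mul_stdNormalPDF.integrableOn,
    integral_const_mul, integral_Iic_neg_mul_stdNormalPDF, stdNormalCDF]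

lemma gaussianReal_eq_map_zero_one (μ σ : ℝ) :
    gaussianReal μ (Real.toNNReal (σ ^ 2)) = (gaussianReal 0 1).map fun x ↦ σ * x + μ := by
  have h : (fun x ↦ σ * x + μ) = (fun x ↦ x + μ) ∘ fun x ↦ σ * x := rfl
  rw [h, ← Measure.map_map (by fun_prop) (by fun_prop), gaussianReal_map_const_mul,
    gaussianReal_map_add_const, mul_zero, zero_add, mul_one, Real.toNNReal_of_nonneg (sq_nonneg σ)]

/-- Expected improvement under a Gaussian predictive distribution:
`E[max(0, ρ − Y)] = (ρ − μ)·Φ(z) + σ·φ(z)` with `z = (ρ − μ)/σ`. -/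
theorem expected_improvement_gaussian (ρ μ σ : ℝ) (hσ : 0 < σ) :
    ∫ y, max 0 (ρ - y) ∂(gaussianReal μ (Real.toNNReal (σ ^ 2))) =
      (ρ - μ) * stdNormalCDF ((ρ - μ) / σ) + σ * stdNormalPDF ((ρ - μ) / σ) := by
  rw [gaussianReal_eq_map_zero_one, integral_map (by fun_prop) (by fun_prop)]
  have hscale (x : ℝ) : max 0 (ρ - (σ * x + μ)) = σ * max 0 ((ρ - μ) / σ - x) := by
    rw [mul_max_of_nonneg _ _ hσ.le, mul_zero, mul_sub, mul_div_cancel₀ _ hσ.ne']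
    congr 1
    ring
  simp_rw [hscale]
  rw [integral_const_mul, integral_max_sub_gaussianReal_zero_one, mul_add, ← mul_assoc,
    mul_div_cancel₀ _ hσ.ne']
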